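/- There is an absolute constant C > 0 with the following property. Let H ≥ 1, let c : ℕ → ℂ be finitely supported, write S_c(α) := Σ_{n≥1} c(n) e(nα), and let S ⊆ [0,1] be a measurable set. Suppose B ≥ 0 is such that for every α ∈ S one has ∫_{β ∈ S, ‖β−α‖ ≤ 1/(2H)} |S_c(β)|² dβ ≤ B. Then Σ_{h∈ℤ, |h|≤H} | ∫_S |S_c(α)|² e(−hα) dα |² ≤ C · H · (Σ_{n≥1} |c(n)|²) · B. -/

import Mathlib

open MeasureTheory

/-- `e(x) = e^{2πix}`. -/
noncomputable def e (x : ℝ) : ℂ := Complex.exp (2 * Real.pi * Complex.I * (x : ℂ))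

lemma e_eq (x : ℝ) : e x = Complex.exp ((2 * Real.pi * x : ℝ) * Complex.I) := by
  unfold e
  congr 1
  push_cast
  ring

lemma norm_e (x : ℝ) : ‖e x‖ = 1 := by
  rw [e_eq, Complex.norm_exp_ofReal_mul_I]

lemma e_add (x y : ℝ) : e (x + y) = e x * e y := by
  unfold e
  rw [← Complex.exp_add]
  congr 1
  push_cast
  ring

lemma continuous_e : Continuous e := by
  unfold e
  fun_prop

lemma e_intCast (n : ℤ) : e n = 1 := by
  unfold e
  rw [← Complex.exp_int_mul_two_pi_mul_I n]
  congr 1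
  push_cast
  ring

lemma re_e (x : ℝ) : (e x).re = Real.cos (2 * Real.pi * x) := by
  rw [e_eq, Complex.exp_ofReal_mul_I_re]

lemma star_e (x : ℝ) : (starRingEnd ℂ) (e x) = e (-x) := by
  rw [e_eq, e_eq, ← Complex.exp_conj]
  congr 1
  rw [map_mul, Complex.conj_ofReal, Complex.conj_I]
  push_cast
  ring

lemma integral_e_intCast_mul (k : ℤ) :
    ∫ x in (0 : ℝ)..1, e ((k : ℝ) * x) = if k = 0 then 1 else 0 := by
  split_ifs with hk
  · subst hk
    have : e 0 = 1 := by simpa using e_intCast 0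
    simp [this]
  · have h : ∀ x : ℝ, e ((k : ℝ) * x) = Complex.exp ((2 * Real.pi * Complex.I * k) * x) := by
      intro x
      unfold e
      congr 1
      push_cast
      ring
    simp only [h]
    rw [integral_exp_mul_complex (by simp [Real.pi_ne_zero, hk])]
    have h1 := h 1
    have h0 := h 0
    rw [← h1, ← h0, mul_one, e_intCast, mul_zero]
    have : e 0 = 1 := by simpa using e_intCast 0
    simp [this]

/-- Parseval's identity for trigonometric polynomials. -/
lemma integral_norm_sq_sum_e (s : Finset ℕ) (c : ℕ → ℂ) :
    ∫ x in (0 : ℝ)..1, ‖∑ n ∈ s, c n * e ((n : ℝ) * x)‖ ^ 2 = ∑ n ∈ s, ‖c n‖ ^ 2 := by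
  have hexp : ∀ x : ℝ, ((‖∑ n ∈ s, c n * e ((n : ℝ) * x)‖ ^ 2 : ℝ) : ℂ) =
      ∑ n ∈ s, ∑ m ∈ s, c n * (starRingEnd ℂ) (c m) * e (((n - m : ℤ) : ℝ) * x) := by
    intro x
    push_cast
    rw [← Complex.mul_conj', map_sum, Finset.sum_mul_sum]
    refine Finset.sum_congr rfl fun n _ => Finset.sum_congr rfl fun m _ => ?_
    rw [map_mul, star_e, mul_mul_mul_comm, ← e_add]
    congr 2
    ring
  have hint : ∀ n m : ℕ, IntervalIntegrable
      (fun x : ℝ => c n * (starRingEnd ℂ) (c m) * e (((n - m : ℤ) : ℝ) * x)) volume 0 1 := by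
    intro n m
    apply Continuous.intervalIntegrable
    exact continuous_const.mul (continuous_e.comp (by fun_prop))
  apply Complex.ofReal_injective
  rw [← intervalIntegral.integral_ofReal]
  simp only [hexp]
  rw [intervalIntegral.integral_finsetSum
    (fun n _ => by
      simpa only [Finset.sum_fn] using IntervalIntegrable.sum s fun m _ => hint n m)]
  rw [Complex.ofReal_sum]
  refine Finset.sum_congr rfl fun n hn => ?_
  rw [intervalIntegral.integral_finsetSum (fun m _ => hint n m)]
  simp only [intervalIntegral.integral_const_mul, integral_e_intCast_mul]
  rw [Finset.sum_eq_single n]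
  · simp [Complex.mul_conj']
  · intro m _ hmn
    rw [if_neg, mul_zero]
    omega
  · exact fun h => absurd hn h

/-- The indicator function of the arc `‖t‖ ≤ δ` on the unit circle, as a function on `ℝ`. -/
noncomputable def arcIndicator (δ t : ℝ) : ℝ :=
  {t : ℝ | ‖(t : UnitAddCircle)‖ ≤ δ}.indicator 1 t

lemma continuous_norm_coe_unitAddCircle : Continuous fun t : ℝ => ‖(t : UnitAddCircle)‖ :=
  (AddCircle.continuous_mk' (1 : ℝ)).norm

lemma measurable_arcIndicator (δ : ℝ) : Measurable (arcIndicator δ) :=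
  measurable_one.indicator
    (isClosed_le continuous_norm_coe_unitAddCircle continuous_const).measurableSet

lemma arcIndicator_nonneg (δ t : ℝ) : 0 ≤ arcIndicator δ t :=
  Set.indicator_nonneg (fun _ _ => zero_le_one) _

lemma arcIndicator_le_one (δ t : ℝ) : arcIndicator δ t ≤ 1 :=
  Set.indicator_le_self' (fun _ _ => zero_le_one) _

lemma arcIndicator_add_one (δ t : ℝ) : arcIndicator δ (t + 1) = arcIndicator δ t := by
  simp [arcIndicator, Set.indicator_apply]

lemma arcIndicator_eq_indicator_Icc {δ t : ℝ} (ht : |t| ≤ 1 / 2) :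
    arcIndicator δ t = (Set.Icc (-δ) δ).indicator 1 t := by
  have : ‖(t : UnitAddCircle)‖ = |t| :=
    (AddCircle.norm_coe_eq_abs_iff 1 one_ne_zero).2 (by simpa using ht)
  simp [arcIndicator, Set.indicator_apply, this, abs_le]

lemma integral_arcIndicator_mul_e {δ : ℝ} (h0 : 0 ≤ δ) (h1 : δ < 1 / 2) (h : ℤ) (y : ℝ) :
    ∫ x in (0 : ℝ)..1, (arcIndicator δ (x - y) : ℂ) * e (-(h : ℝ) * x) =
      e (-(h : ℝ) * y) * ∫ u in (-δ)..δ, e (-(h : ℝ) * u) := by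
  have hper : Function.Periodic
      (fun x : ℝ => (arcIndicator δ (x - y) : ℂ) * e (-(h : ℝ) * x)) 1 := by
    intro x
    have h2 : -(h : ℝ) * (x + 1) = -(h : ℝ) * x + ((-h : ℤ) : ℝ) := by push_cast; ring
    simp only [h2, e_add, e_intCast, mul_one]
    rw [show x + 1 - y = x - y + 1 by ring, arcIndicator_add_one]
  have hshift := hper.intervalIntegral_add_eq 0 (-(1 / 2) + y)
  rw [zero_add] at hshift
  rw [hshift]
  have hcongr : (fun x : ℝ => (arcIndicator δ (x - y) : ℂ) * e (-(h : ℝ) * x)) =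
      fun x => (fun u : ℝ => e (-(h : ℝ) * y) * ((arcIndicator δ u : ℂ) * e (-(h : ℝ) * u)))
        (x - y) := by
    funext x
    have h2 : -(h : ℝ) * x = -(h : ℝ) * y + -(h : ℝ) * (x - y) := by ring
    simp only
    rw [h2, e_add]
    ring
  rw [hcongr, intervalIntegral.integral_comp_sub_right
    (fun u : ℝ => e (-(h : ℝ) * y) * ((arcIndicator δ u : ℂ) * e (-(h : ℝ) * u)))]
  rw [intervalIntegral.integral_const_mul]
  congr 1
  rw [show -(1 / 2) + y - y = (-(1 / 2) : ℝ) by ring,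
    show -(1 / 2) + y + 1 - y = (1 / 2 : ℝ) by ring,
    intervalIntegral.integral_of_le (by norm_num), intervalIntegral.integral_of_le (by linarith),
    ← integral_Icc_eq_integral_Ioc, ← integral_Icc_eq_integral_Ioc]
  have hind : Set.EqOn (fun u : ℝ => (arcIndicator δ u : ℂ) * e (-(h : ℝ) * u))
      ((Set.Icc (-δ) δ).indicator fun u : ℝ => e (-(h : ℝ) * u)) (Set.Icc (-(1 / 2)) (1 / 2)) := by
    intro u hu
    simp only
    rw [arcIndicator_eq_indicator_Icc (abs_le.2 hu)]
    by_cases hm : u ∈ Set.Icc (-δ) δ <;> simp [hm, -Set.mem_Icc]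
  rw [setIntegral_congr_fun measurableSet_Icc hind, setIntegral_indicator measurableSet_Icc,
    Set.inter_eq_right.2 (Set.Icc_subset_Icc (by linarith) h1.le)]

lemma le_norm_integral_e {H : ℝ} (hH : 1 ≤ H) {h : ℤ} (hh : |(h : ℝ)| ≤ H) :
    1 / (4 * H) ≤ ‖∫ u in (-(1 / (4 * H)))..(1 / (4 * H)), e (-(h : ℝ) * u)‖ := by
  have hH0 : 0 < H := by linarith
  have hcont : Continuous fun u : ℝ => e (-(h : ℝ) * u) := continuous_e.comp (by fun_prop)
  have hδ : 0 < 1 / (4 * H) := by positivity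
  refine le_trans ?_ (Complex.re_le_norm _)
  have hre := Complex.reCLM.intervalIntegral_comp_comm
    (hcont.intervalIntegrable (μ := volume) (-(1 / (4 * H))) (1 / (4 * H)))
  simp only [Complex.reCLM_apply] at hre
  rw [← hre]
  have hlow : ∫ u in (-(1 / (4 * H)))..(1 / (4 * H)), (1 - 2 * Real.pi ^ 2 * H ^ 2 * u ^ 2) ≤
      ∫ u in (-(1 / (4 * H)))..(1 / (4 * H)), (e (-(h : ℝ) * u)).re := by
    apply intervalIntegral.integral_mono_on (by linarith)
    · exact Continuous.intervalIntegrable (by fun_prop) _ _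
    · exact (Complex.continuous_re.comp hcont).intervalIntegrable _ _
    · intro u _
      rw [re_e]
      refine le_trans ?_ Real.one_sub_sq_div_two_le_cos
      have h2 : (h : ℝ) ^ 2 ≤ H ^ 2 := sq_le_sq' (by linarith [neg_le_of_abs_le hh])
        (le_of_abs_le hh)
      have h3 := mul_le_mul_of_nonneg_left h2 (by positivity : 0 ≤ 2 * Real.pi ^ 2 * u ^ 2)
      nlinarith [h3]
  refine le_trans ?_ hlow
  rw [intervalIntegral.integral_sub (by simp) (Continuous.intervalIntegrable (by fun_prop) _ _),
    intervalIntegral.integral_const_mul, integral_pow, intervalIntegral.integral_const]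
  have hpi : Real.pi ^ 2 ≤ 12 := by nlinarith [Real.pi_lt_d2, Real.pi_pos]
  have hval : (1 / (4 * H) - -(1 / (4 * H))) • (1 : ℝ) - 2 * Real.pi ^ 2 * H ^ 2 *
      (((1 / (4 * H)) ^ (2 + 1) - (-(1 / (4 * H))) ^ (2 + 1)) / ((2 : ℕ) + 1)) =
      (2 - Real.pi ^ 2 / 12) * (1 / (4 * H)) := by
    simp only [smul_eq_mul]
    push_cast
    field_simp
    ring
  rw [hval]
  nlinarith

lemma hasSum_norm_integral_mul_e_sq {g : ℝ → ℝ} (hg : Measurable g) {B : ℝ}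
    (hB : ∀ x, ‖g x‖ ≤ B) :
    HasSum (fun h : ℤ => ‖∫ x in (0 : ℝ)..1, (g x : ℂ) * e (-(h : ℝ) * x)‖ ^ 2)
      (∫ x in (0 : ℝ)..1, g x ^ 2) := by
  have hmem : MemLp (fun x => (g x : ℂ)) 2 (volume.restrict (Set.Ioc (0 : ℝ) 1)) :=
    MemLp.of_bound (Complex.measurable_ofReal.comp hg).aestronglyMeasurable B
      (Filter.Eventually.of_forall fun x => by simpa using hB x)
  have key := hasSum_sq_fourierCoeffOn zero_lt_one hmem
  simp only [fourierCoeffOn_eq_integral] at key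
  convert key using 1
  · funext h
    congr 2
    simp only [sub_zero, div_one, one_smul]
    refine intervalIntegral.integral_congr fun x _ => ?_
    simp only [smul_eq_mul]
    rw [mul_comm, fourier_coe_apply, e]
    congr 2
    push_cast
    ring
  · simp

/-- The mass that `f` puts on the part of `S` within circle distance `δ` of `x`. -/
noncomputable def arcMass (f : ℝ → ℝ) (S : Set ℝ) (δ x : ℝ) : ℝ :=
  ∫ y in S, arcIndicator δ (x - y) * f y

section ArcMass

variable {f : ℝ → ℝ} {S : Set ℝ} {δ M : ℝ}

lemma measurable_arcIndicator_sub_mul (hf : Measurable f) :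
    Measurable fun p : ℝ × ℝ => arcIndicator δ (p.1 - p.2) * f p.2 :=
  ((measurable_arcIndicator δ).comp (measurable_fst.sub measurable_snd)).mul
    (hf.comp measurable_snd)

lemma norm_arcIndicator_mul_le (hM : ∀ y, ‖f y‖ ≤ M) (x y : ℝ) :
    ‖arcIndicator δ (x - y) * f y‖ ≤ M := by
  rw [norm_mul, Real.norm_of_nonneg (arcIndicator_nonneg _ _)]
  exact (mul_le_of_le_one_left (norm_nonneg _) (arcIndicator_le_one _ _)).trans (hM y)

lemma measurable_arcMass (hf : Measurable f) : Measurable (arcMass f S δ) :=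
  ((measurable_arcIndicator_sub_mul hf).stronglyMeasurable.integral_prod_right).measurable

lemma arcMass_nonneg (h0 : ∀ y, 0 ≤ f y) (x : ℝ) : 0 ≤ arcMass f S δ x :=
  integral_nonneg fun y => mul_nonneg (arcIndicator_nonneg _ _) (h0 y)

lemma arcMass_le (hf : Measurable f) (h0 : ∀ y, 0 ≤ f y) (hM : ∀ y, ‖f y‖ ≤ M)
    (hfin : volume S ≠ ⊤) {B : ℝ} (hB : 0 ≤ B)
    (hloc : ∀ α ∈ S, ∫ β in {β : ℝ | β ∈ S ∧ ‖((β - α : ℝ) : UnitAddCircle)‖ ≤ 2 * δ}, f β ≤ B)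
    (x : ℝ) : arcMass f S δ x ≤ B := by
  have hmeas : MeasurableSet {y : ℝ | ‖((x - y : ℝ) : UnitAddCircle)‖ ≤ δ} :=
    (isClosed_le (continuous_norm_coe_unitAddCircle.comp (by fun_prop : Continuous fun y => x - y))
      continuous_const).measurableSet
  have heq : arcMass f S δ x =
      ∫ y in S ∩ {y : ℝ | ‖((x - y : ℝ) : UnitAddCircle)‖ ≤ δ}, f y := by
    rw [arcMass, ← setIntegral_indicator hmeas]
    congr 1
    funext y
    by_cases hy : ‖((x - y : ℝ) : UnitAddCircle)‖ ≤ δ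
    · simp only [arcIndicator, Set.indicator_apply, Set.mem_ofPred_eq, if_pos hy]
      simp
    · simp only [arcIndicator, Set.indicator_apply, Set.mem_ofPred_eq, if_neg hy, zero_mul]
  rw [heq]
  rcases Set.eq_empty_or_nonempty (S ∩ {y : ℝ | ‖((x - y : ℝ) : UnitAddCircle)‖ ≤ δ}) with
    hem | ⟨α, hα, hxα⟩
  · rw [hem]
    simpa using hB
  · refine le_trans (setIntegral_mono_set ?_ (Filter.Eventually.of_forall h0)
      (LE.le.eventuallyLE ?_)) (hloc α hα)
    · have : IsFiniteMeasure
          (volume.restrict {β : ℝ | β ∈ S ∧ ‖((β - α : ℝ) : UnitAddCircle)‖ ≤ 2 * δ}) :=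
        isFiniteMeasure_restrict.2
          (measure_ne_top_of_subset (fun β (hβ : β ∈ S ∧ _) => hβ.1) hfin)
      exact Integrable.of_bound hf.aestronglyMeasurable M (Filter.Eventually.of_forall hM)
    · rintro β ⟨hβ, hxβ⟩
      refine ⟨hβ, ?_⟩
      rw [Set.mem_ofPred_eq] at hxα hxβ
      have : ((β - α : ℝ) : UnitAddCircle) =
          ((x - α : ℝ) : UnitAddCircle) - ((x - β : ℝ) : UnitAddCircle) := by
        rw [← AddCircle.coe_sub]
        congr 1
        ring
      rw [this]
      linarith [norm_sub_le ((x - α : ℝ) : UnitAddCircle) ((x - β : ℝ) : UnitAddCircle)]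

lemma integral_arcMass_mul_e (hf : Measurable f) (hM : ∀ y, ‖f y‖ ≤ M) (hfin : volume S ≠ ⊤)
    (hδ0 : 0 ≤ δ) (hδ : δ < 1 / 2) (h : ℤ) :
    ∫ x in (0 : ℝ)..1, (arcMass f S δ x : ℂ) * e (-(h : ℝ) * x) =
      (∫ y in S, (f y : ℂ) * e (-(h : ℝ) * y)) * ∫ u in (-δ)..δ, e (-(h : ℝ) * u) := by
  have : IsFiniteMeasure (volume.restrict S) := isFiniteMeasure_restrict.2 hfin
  have hmeas_e : Measurable fun x : ℝ => e (-(h : ℝ) * x) :=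
    (continuous_e.comp (by fun_prop)).measurable
  rw [intervalIntegral.integral_of_le zero_le_one]
  have hinner : ∀ x : ℝ, (arcMass f S δ x : ℂ) * e (-(h : ℝ) * x) =
      ∫ y in S, ((arcIndicator δ (x - y) * f y : ℝ) : ℂ) * e (-(h : ℝ) * x) := by
    intro x
    rw [integral_mul_const, arcMass, integral_complex_ofReal]
  simp only [hinner]
  rw [integral_integral_swap]
  · rw [← integral_mul_const]
    refine integral_congr_ae (Filter.Eventually.of_forall fun y => ?_)
    have hK := integral_arcIndicator_mul_e hδ0 hδ h y
    rw [intervalIntegral.integral_of_le zero_le_one] at hK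
    simp only
    rw [mul_assoc, ← hK, ← integral_const_mul]
    congr 1
    funext x
    push_cast
    ring
  · refine Integrable.of_bound (Measurable.aestronglyMeasurable ?_) M
      (Filter.Eventually.of_forall fun p => ?_)
    · exact (Complex.measurable_ofReal.comp (measurable_arcIndicator_sub_mul hf)).mul
        (hmeas_e.comp measurable_fst)
    · simp only [Function.uncurry, norm_mul (_ : ℂ), norm_e, mul_one, Complex.norm_real]
      exact norm_arcIndicator_mul_le hM _ _

/-- A nonnegative function with small mass on short arcs around the points of `S` has small
low-frequency Fourier coefficients in mean square. -/
lemma tsum_norm_setIntegral_mul_e_sq_le (hf : Measurable f) (h0 : ∀ y, 0 ≤ f y)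
    (hM : ∀ y, ‖f y‖ ≤ M) (hfin : volume S ≠ ⊤) {H B : ℝ} (hH : 1 ≤ H)
    (hB : 0 ≤ B)
    (hloc : ∀ α ∈ S,
      ∫ β in {β : ℝ | β ∈ S ∧ ‖((β - α : ℝ) : UnitAddCircle)‖ ≤ 1 / (2 * H)}, f β ≤ B) :
    (∑' h : ℤ, if |(h : ℝ)| ≤ H then ‖∫ y in S, (f y : ℂ) * e (-(h : ℝ) * y)‖ ^ 2 else 0) ≤
      8 * H * (∫ y in S, f y) * B := by
  have hH0 : 0 < H := by linarith
  have hδ0 : (0 : ℝ) ≤ 1 / (4 * H) := by positivity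
  have hδ : 1 / (4 * H) < 1 / 2 := by
    apply one_div_lt_one_div_of_lt <;> linarith
  set g := arcMass f S (1 / (4 * H)) with hg
  have hgm : Measurable g := measurable_arcMass hf
  have hg0 : ∀ x, 0 ≤ g x := arcMass_nonneg h0
  have hgB : ∀ x, g x ≤ B := by
    refine arcMass_le hf h0 hM hfin hB ?_
    rwa [show 2 * (1 / (4 * H)) = 1 / (2 * H) by field_simp; norm_num]
  have hgn : ∀ x, ‖g x‖ ≤ B := fun x => by rw [Real.norm_of_nonneg (hg0 x)]; exact hgB x
  have hsum := (hasSum_norm_integral_mul_e_sq hgm hgn).mul_left (16 * H ^ 2)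
  have hle : ∀ h : ℤ,
      (if |(h : ℝ)| ≤ H then ‖∫ y in S, (f y : ℂ) * e (-(h : ℝ) * y)‖ ^ 2 else 0) ≤
        16 * H ^ 2 * ‖∫ x in (0 : ℝ)..1, (g x : ℂ) * e (-(h : ℝ) * x)‖ ^ 2 := by
    intro h
    split_ifs with hh
    · rw [hg, integral_arcMass_mul_e hf hM hfin hδ0 hδ, norm_mul, mul_pow]
      have h1 := pow_le_pow_left₀ hδ0 (le_norm_integral_e hH hh) 2
      have h2 : 1 ≤ 16 * H ^ 2 *
          ‖∫ u in (-(1 / (4 * H)))..(1 / (4 * H)), e (-(h : ℝ) * u)‖ ^ 2 := by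
        refine le_trans (le_of_eq ?_) (mul_le_mul_of_nonneg_left h1 (by positivity))
        field_simp
        norm_num
      calc _ ≤ ‖∫ y in S, (f y : ℂ) * e (-(h : ℝ) * y)‖ ^ 2 * _ :=
            le_mul_of_one_le_right (by positivity) h2
        _ = _ := by ring
    · positivity
  have hnonneg : ∀ h : ℤ,
      0 ≤ (if |(h : ℝ)| ≤ H then ‖∫ y in S, (f y : ℂ) * e (-(h : ℝ) * y)‖ ^ 2 else 0) := by
    intro h
    split_ifs <;> positivity
  have hmass : ∫ x in (0 : ℝ)..1, g x = (∫ y in S, f y) * (1 / (2 * H)) := by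
    have := integral_arcMass_mul_e hf hM hfin hδ0 hδ 0
    have he : e 0 = 1 := by simpa using e_intCast 0
    simp only [Int.cast_zero, neg_zero, zero_mul, he, mul_one, intervalIntegral.integral_const,
      intervalIntegral.integral_ofReal, integral_complex_ofReal] at this
    apply Complex.ofReal_injective
    rw [hg, this, Complex.ofReal_mul]
    congr 1
    rw [Complex.real_smul, mul_one]
    congr 1
    field_simp
    norm_num
  have hint : ∀ k : ℕ, IntervalIntegrable (fun x => g x ^ k) volume 0 1 := fun k => by
    rw [intervalIntegrable_iff]
    have : IsFiniteMeasure (volume.restrict (Set.uIoc (0 : ℝ) 1)) :=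
      isFiniteMeasure_restrict.2 (by simp [Set.uIoc])
    exact Integrable.of_bound (hgm.pow_const k).aestronglyMeasurable (B ^ k)
      (Filter.Eventually.of_forall fun x => by
        rw [norm_pow]
        exact pow_le_pow_left₀ (norm_nonneg _) (hgn x) k)
  have hsq : ∫ x in (0 : ℝ)..1, g x ^ 2 ≤ B * ((∫ y in S, f y) * (1 / (2 * H))) := by
    rw [← hmass, ← intervalIntegral.integral_const_mul]
    refine intervalIntegral.integral_mono_on zero_le_one (hint 2)
      ((by simpa using hint 1 : IntervalIntegrable g volume 0 1).const_mul B) fun x _ => ?_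
    rw [pow_two]
    exact mul_le_mul_of_nonneg_right (hgB x) (hg0 x)
  calc _ ≤ ∑' h : ℤ, 16 * H ^ 2 * ‖∫ x in (0 : ℝ)..1, (g x : ℂ) * e (-(h : ℝ) * x)‖ ^ 2 :=
        (hsum.summable.of_nonneg_of_le hnonneg hle).tsum_le_tsum hle hsum.summable
    _ = 16 * H ^ 2 * ∫ x in (0 : ℝ)..1, g x ^ 2 := hsum.tsum_eq
    _ ≤ 16 * H ^ 2 * (B * ((∫ y in S, f y) * (1 / (2 * H)))) :=
        mul_le_mul_of_nonneg_left hsq (by positivity)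
    _ = 8 * H * (∫ y in S, f y) * B := by
        field_simp
        ring

end ArcMass

/-- The smoothing/Parseval estimate (3.3) from the proof of Theorem 1.1: there is
an absolute constant `C > 0` such that for every `H ≥ 1`, every finitely supported
`c : ℕ → ℂ` (with `c 0 = 0`), writing `S_c(α) = ∑_{n≥1} c(n) e(nα)`, every
measurable `S ⊆ [0,1]` and `B ≥ 0` satisfying
`∫_{β ∈ S, ‖β-α‖ ≤ 1/(2H)} |S_c(β)|² dβ ≤ B` for all `α ∈ S` (here `‖t‖` is the
distance from `t` to the nearest integer), one has
`∑_{|h| ≤ H} |∫_S |S_c(α)|² e(-hα) dα|² ≤ C H (∑_n |c(n)|²) B`. -/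
theorem stmt_11 :
    ∃ C : ℝ, 0 < C ∧
      ∀ (H : ℝ), 1 ≤ H → ∀ c : ℕ → ℂ, (Function.support c).Finite → c 0 = 0 →
        ∀ S : Set ℝ, MeasurableSet S → S ⊆ Set.Icc 0 1 →
        ∀ B : ℝ, 0 ≤ B →
        (∀ α ∈ S,
          (∫ β in {β : ℝ | β ∈ S ∧ |(β - α) - (round (β - α) : ℝ)| ≤ 1 / (2 * H)},
              ‖∑' n : ℕ, c n * e ((n : ℝ) * β)‖ ^ 2) ≤ B) →
        (∑' h : ℤ, if |(h : ℝ)| ≤ H then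
            ‖∫ α in S, (‖∑' n : ℕ, c n * e ((n : ℝ) * α)‖ ^ 2 : ℂ) *
                e (-(h : ℝ) * α)‖ ^ 2
          else 0)
          ≤ C * H * (∑' n : ℕ, ‖c n‖ ^ 2) * B := by
  refine ⟨8, by norm_num, fun H hH c hc _ S hS hS01 B hB hloc => ?_⟩
  set s := hc.toFinset with hs
  have hout : ∀ n ∉ s, c n = 0 := fun n hn => by
    simpa [hs] using hn
  have hSc : ∀ x : ℝ, ∑' n : ℕ, c n * e ((n : ℝ) * x) = ∑ n ∈ s, c n * e ((n : ℝ) * x) :=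
    fun x => tsum_eq_sum fun n hn => by rw [hout n hn, zero_mul]
  have hsq : ∑' n : ℕ, ‖c n‖ ^ 2 = ∑ n ∈ s, ‖c n‖ ^ 2 :=
    tsum_eq_sum fun n hn => by simp [hout n hn]
  simp only [hSc] at hloc ⊢
  rw [hsq]
  set f : ℝ → ℝ := fun x => ‖∑ n ∈ s, c n * e ((n : ℝ) * x)‖ ^ 2 with hf
  have hcont : Continuous f := by
    have : ∀ n : ℕ, Continuous fun x : ℝ => e ((n : ℝ) * x) :=
      fun n => continuous_e.comp (by fun_prop)
    fun_prop
  have h0 : ∀ x, 0 ≤ f x := fun x => by positivity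
  have hM : ∀ x, ‖f x‖ ≤ (∑ n ∈ s, ‖c n‖) ^ 2 := fun x => by
    rw [Real.norm_of_nonneg (h0 x)]
    refine pow_le_pow_left₀ (norm_nonneg _) ((norm_sum_le _ _).trans (le_of_eq ?_)) 2
    simp [norm_e]
  have hfin : volume S ≠ ⊤ := measure_ne_top_of_subset hS01 (by simp)
  have hmain := tsum_norm_setIntegral_mul_e_sq_le (M := (∑ n ∈ s, ‖c n‖) ^ 2)
    hcont.measurable h0 hM hfin hH hB
    (by simpa only [UnitAddCircle.norm_eq] using hloc)
  have hpars : ∫ y in S, f y ≤ ∑ n ∈ s, ‖c n‖ ^ 2 := by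
    rw [← integral_norm_sq_sum_e, intervalIntegral.integral_of_le zero_le_one,
      ← integral_Icc_eq_integral_Ioc]
    exact setIntegral_mono_set (hcont.continuousOn.integrableOn_compact isCompact_Icc)
      (Filter.Eventually.of_forall h0) hS01.eventuallyLE
  simp only [hf, Complex.ofReal_pow] at hmain
  refine hmain.trans ?_
  gcongr
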